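/- For every integer n ≥ 0, Σ_{j=0}^{∞} (−1)^{T_j} Q(n − T_j) equals (−1)^{T_m} if n = 4G_m for some (necessarily unique) integer m ≥ 0, and equals 0 otherwise; the sum is finite since Q vanishes on negative arguments. -/

import Mathlib

/-- The `n`-th triangular number `T n = n(n+1)/2`. -/
def T (n : ℕ) : ℕ := n * (n + 1) / 2

/-- The `n`-th generalized pentagonal number `G n = T n - T ⌊n/2⌋`. -/
def G (n : ℕ) : ℕ := T n - T (n / 2)

/-- The number of partitions of `n` into distinct parts, vanishing on negative integers. -/
def Q (n : ℤ) : ℤ :=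
  if 0 ≤ n then ((Nat.Partition.distincts n.toNat).card : ℤ) else 0

open Classical in
/-- `ε(n) = (-1)^(T m)` if `n = 4 G m` for the (unique) `m`, and `0` otherwise. -/
noncomputable def eps (n : ℕ) : ℤ := if h : ∃ m, n = 4 * G m then (-1) ^ (T h.choose) else 0

open Finset PowerSeries

lemma two_mul_T (n : ℕ) : 2 * T n = n * (n + 1) :=
  Nat.mul_div_cancel' (Nat.even_mul_succ_self n).two_dvd

lemma T_two_mul (n : ℕ) : T (2 * n) = n * (2 * n + 1) := by
  have := two_mul_T (2 * n)
  grind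

lemma T_two_mul_add_one (n : ℕ) : T (2 * n + 1) = (n + 1) * (2 * n + 1) := by
  have := two_mul_T (2 * n + 1)
  grind

lemma le_T (n : ℕ) : n ≤ T n := by
  have := two_mul_T n
  nlinarith

lemma G_two_mul (k : ℕ) : G (2 * k) = pentagonal (-k) := by
  have h := two_mul_T k
  have h' := two_mul_natCast_pentagonal_neg k
  rw [G, T_two_mul, Nat.mul_div_cancel_left k two_pos]
  zify at h
  have : k * (2 * k + 1) = T k + pentagonal (-k) := by zify; linarith
  omega

lemma G_two_mul_add_one (k : ℕ) : G (2 * k + 1) = pentagonal (k + 1) := by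
  have h := two_mul_T k
  have h' := two_mul_natCast_pentagonal (k + 1)
  rw [G, T_two_mul_add_one, show (2 * k + 1) / 2 = k by omega]
  zify at h
  have : (k + 1) * (2 * k + 1) = T k + pentagonal (k + 1) := by zify; linarith
  omega

/-- Generalized pentagonal numbers indexed by `ℕ` are pentagonal numbers indexed by `ℤ`, with
matching signs. -/
lemma exists_pentagonal_eq_G (m : ℕ) :
    ∃ k : ℤ, G m = pentagonal k ∧ (-1 : ℤ) ^ T m = (k.negOnePow : ℤ) := by
  obtain ⟨k, rfl | rfl⟩ := m.even_or_odd'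
  · refine ⟨-k, G_two_mul k, ?_⟩
    rw [T_two_mul, mul_comm, pow_mul, Odd.neg_one_pow ⟨k, rfl⟩]
    simp [Int.coe_negOnePow_natCast]
  · refine ⟨k + 1, G_two_mul_add_one k, ?_⟩
    rw [T_two_mul_add_one, mul_comm, pow_mul, Odd.neg_one_pow ⟨k, rfl⟩]
    simp [Int.negOnePow_succ, pow_succ, Int.coe_negOnePow_natCast]

lemma exists_G_eq_pentagonal (k : ℤ) : ∃ m, G m = pentagonal k := by
  obtain ⟨j, rfl | rfl⟩ := k.eq_nat_or_neg
  · rcases j with _ | j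
    · exact ⟨0, by simpa using G_two_mul 0⟩
    · exact ⟨2 * j + 1, by simpa using G_two_mul_add_one j⟩
  · exact ⟨2 * j, G_two_mul j⟩

lemma eps_eq_coeff_pentagonalSeries (n : ℕ) :
    eps n = if 4 ∣ n then (pentagonalSeries ℤ).coeff (n / 4) else 0 := by
  rw [eps]
  split_ifs with h hn hn
  · obtain ⟨k, hk, hs⟩ := exists_pentagonal_eq_G h.choose
    have hq : n / 4 = pentagonal k := by have := h.choose_spec; omega
    rw [hs, hq, coeff_pentagonalSeries_pentagonal, Int.cast_id]
  · exact absurd ⟨_, h.choose_spec⟩ hn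
  · rw [coeff_pentagonalSeries_eq_zero]
    rintro ⟨k, hk⟩
    obtain ⟨m, hm⟩ := exists_G_eq_pentagonal k
    exact h ⟨m, by omega⟩
  · rfl

/-- A finite form, due to Shanks, of Gauss's identity for the series `∑ q ^ (n(n+1)/2)`. -/
theorem prod_mul_sum_pow_T {R : Type*} [CommRing R] (q : R) (n : ℕ) :
    (∏ j ∈ range n, (1 - q ^ (2 * j + 1))) * ∑ j ∈ range (2 * n), q ^ T j =
      ∑ s ∈ range n, q ^ (s * (2 * n + 1)) * (∏ j ∈ Ico s n, (1 - q ^ (2 * (j + 1)))) *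
        ∏ j ∈ range s, (1 - q ^ (2 * j + 1)) := by
  induction n with
  | zero => simp
  | succ n ih =>
    let g (s : ℕ) : R := q ^ (s * (2 * n + 1)) * (1 - q ^ (2 * s)) *
      (∏ j ∈ Ico s n, (1 - q ^ (2 * (j + 1)))) * ∏ j ∈ range s, (1 - q ^ (2 * j + 1))
    have hg : ∑ s ∈ range n, (g (s + 1) - g s) = g n := by
      rw [sum_range_sub]
      simp [g]
    have hterm : ∀ s ∈ range n,
        q ^ (s * (2 * (n + 1) + 1)) * (∏ j ∈ Ico s (n + 1), (1 - q ^ (2 * (j + 1)))) *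
          ∏ j ∈ range s, (1 - q ^ (2 * j + 1)) =
        (1 - q ^ (2 * n + 1)) * (q ^ (s * (2 * n + 1)) *
          (∏ j ∈ Ico s n, (1 - q ^ (2 * (j + 1)))) * ∏ j ∈ range s, (1 - q ^ (2 * j + 1))) +
        (g (s + 1) - g s) := by
      intro s hs
      have hs := mem_range.mp hs
      simp only [g]
      rw [prod_Ico_succ_top hs.le, prod_eq_prod_Ico_succ_bot hs, prod_range_succ]
      ring
    rw [sum_range_succ, sum_congr rfl hterm, sum_add_distrib, hg, ← mul_sum, ← ih,
      show 2 * (n + 1) = 2 * n + 1 + 1 by ring, sum_range_succ, sum_range_succ, T_two_mul,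
      T_two_mul_add_one, prod_range_succ, prod_Ico_succ_top le_rfl]
    simp only [g, Ico_self, prod_empty]
    ring

lemma pow_dvd_prod_mul_sum_pow_T_sub_prod {R : Type*} [CommRing R] (q : R) {n : ℕ} (hn : 0 < n) :
    q ^ (2 * n + 1) ∣ (∏ j ∈ range n, (1 - q ^ (2 * j + 1))) * ∑ j ∈ range (2 * n), q ^ T j -
      ∏ j ∈ range n, (1 - q ^ (2 * (j + 1))) := by
  obtain ⟨n, rfl⟩ := Nat.exists_eq_add_one.mpr hn
  rw [prod_mul_sum_pow_T, sum_range_succ']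
  simp only [zero_mul, pow_zero, one_mul, range_zero, prod_empty, mul_one, Nat.Ico_zero_eq_range,
    add_sub_cancel_right]
  refine dvd_sum fun s _ ↦ Dvd.dvd.mul_right (Dvd.dvd.mul_right (pow_dvd_pow q ?_) _) _
  exact Nat.le_mul_of_pos_left _ s.succ_pos

lemma prod_range_two_mul {M : Type*} [CommMonoid M] (f : ℕ → M) (n : ℕ) :
    ∏ i ∈ range (2 * n), f i =
      (∏ i ∈ range n, f (2 * i)) * ∏ i ∈ range n, f (2 * i + 1) := by
  rw [← prod_mul_distrib]
  induction n with
  | zero => simp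
  | succ n ih => rw [mul_add_one, prod_range_succ, prod_range_succ, prod_range_succ, ih, mul_assoc]

/-- Gauss's identity `∑ (-x) ^ (j(j+1)/2) * ∏ (1 + x ^ i) = ∏ (1 - x ^ (4 i))`, truncated. -/
lemma pow_dvd_prod_mul_sum_neg_pow_T_sub_prod {R : Type*} [CommRing R] (x : R) {n : ℕ}
    (hn : 0 < n) :
    x ^ (2 * n + 1) ∣ (∏ i ∈ range (2 * n), (1 + x ^ (i + 1))) * ∑ j ∈ range (2 * n), (-x) ^ T j -
      ∏ i ∈ range n, (1 - x ^ (4 * (i + 1))) := by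
  have h := pow_dvd_prod_mul_sum_pow_T_sub_prod (-x) hn
  simp only [Odd.neg_pow ⟨_, rfl⟩, Even.neg_pow (even_two_mul _), sub_neg_eq_add,
    neg_dvd] at h
  have hA : ∏ i ∈ range n, (1 - x ^ (4 * (i + 1))) =
      (∏ i ∈ range n, (1 + x ^ (2 * i + 1 + 1))) * ∏ i ∈ range n, (1 - x ^ (2 * (i + 1))) := by
    rw [← prod_mul_distrib]
    exact prod_congr rfl fun i _ ↦ by ring
  rw [prod_range_two_mul, hA, mul_comm (∏ i ∈ range n, (1 + x ^ (2 * i + 1))), mul_assoc,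
    ← mul_sub]
  exact h.mul_left _

open Filter in
lemma coeff_prod_one_add_X_pow_eventually_eq (d : ℕ) :
    ∀ᶠ N in atTop, (∏ i ∈ range N, (1 + X ^ (i + 1) : ℤ⟦X⟧)).coeff d =
      ((Nat.Partition.distincts d).card : ℤ) := by
  have h := Nat.Partition.hasProd_powerSeriesMk_card_countRestricted ℤ two_pos
  simp only [HasProd, WithPiTopology.tendsto_iff_coeff_tendsto, SummationFilter.unconditional_filter,
    nhds_discrete, tendsto_pure, coeff_mk, Nat.Partition.countRestricted_two] at h
  filter_upwards [tendsto_finset_range.eventually (h d)] with N hN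
  rw [← hN]
  congr! 2 with i
  exact ((sum_range_succ _ 1).trans (by simp)).symm

open Filter in
lemma coeff_prod_one_sub_X_pow_mul_eventually_eq (d : ℕ) :
    ∀ᶠ N in atTop, (∏ i ∈ range N, (1 - X ^ (4 * (i + 1)) : ℤ⟦X⟧)).coeff d = eps d := by
  filter_upwards [tendsto_finset_range.eventually
    (coeff_prod_one_sub_X_pow_eventually_eq ℤ (d / 4))] with N hN
  rw [eps_eq_coeff_pentagonalSeries, ← hN]
  have h4 : (∏ i ∈ range N, (1 - X ^ (4 * (i + 1)) : ℤ⟦X⟧)) =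
      ((Polynomial.expand ℤ 4 (∏ i ∈ range N, (1 - Polynomial.X ^ (i + 1))) :
        Polynomial ℤ) : ℤ⟦X⟧) := by
    rw [map_prod, ← Polynomial.coeToPowerSeries.ringHom_apply, map_prod]
    simp [pow_mul]
  have h1 : (∏ i ∈ range N, (1 - X ^ (i + 1) : ℤ⟦X⟧)) =
      ((∏ i ∈ range N, (1 - Polynomial.X ^ (i + 1)) : Polynomial ℤ) : ℤ⟦X⟧) := by
    rw [← Polynomial.coeToPowerSeries.ringHom_apply, map_prod]
    simp
  rw [h4, h1, Polynomial.coeff_coe, Polynomial.coeff_coe, Polynomial.coeff_expand four_pos]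

theorem stmt_14 (n : ℕ) :
    ∑' j : ℕ, (-1 : ℤ) ^ (T j) * Q ((n : ℤ) - (T j : ℤ)) = eps n := by
  have hP : ∀ᶠ N in Filter.atTop, ∀ d ∈ range (n + 1),
      (∏ i ∈ range N, (1 + X ^ (i + 1) : ℤ⟦X⟧)).coeff d =
        ((Nat.Partition.distincts d).card : ℤ) :=
    (Filter.eventually_all_finset _).mpr fun d _ ↦ coeff_prod_one_add_X_pow_eventually_eq d
  have h2 : Filter.Tendsto (fun N : ℕ ↦ 2 * N) Filter.atTop Filter.atTop :=
    Filter.tendsto_id.const_mul_atTop' two_pos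
  obtain ⟨N, hN, hE, hnN⟩ := ((h2.eventually hP).and
    ((coeff_prod_one_sub_X_pow_mul_eventually_eq n).and (Filter.eventually_gt_atTop n))).exists
  have hcoeff := X_pow_dvd_iff.mp
    (pow_dvd_prod_mul_sum_neg_pow_T_sub_prod (X : ℤ⟦X⟧) (n.zero_le.trans_lt hnN)) n (by omega)
  rw [map_sub, hE, sub_eq_zero] at hcoeff
  rw [← hcoeff, tsum_eq_sum (s := range (2 * N)), mul_sum, map_sum]
  · refine sum_congr rfl fun j _ ↦ ?_
    rw [neg_pow (X : ℤ⟦X⟧), show (-1 : ℤ⟦X⟧) ^ T j = C ((-1) ^ T j) by simp, mul_left_comm,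
      coeff_C_mul, coeff_mul_X_pow', Q]
    congr 1
    split_ifs with h h' h'
    · rw [hN _ (by simp), show ((n : ℤ) - T j).toNat = n - T j by omega]
    · omega
    · omega
    · rfl
  · intro j hj
    have := le_T j
    rw [mem_range] at hj
    rw [Q, if_neg (by omega), mul_zero]
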